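/- Let γ = (γ_n)_{n≥1} be a complex sequence such that both the ordinary generating function Γ_γ(z) := ∑_{n≥1} γ_n z^n and the Lambert series L_γ(z) := ∑_{n≥1} γ_n z^n/(1 − z^n) are rational functions (i.e., each formal power series equals P/Q for some polynomials P, Q with Q(0) ≠ 0). Then γ is finitely supported and Γ_γ(z) is a polynomial. -/

import Mathlib

/-- A formal power series `F` is *rational* if there are polynomials `P, Q` with
`Q(0) ≠ 0` such that `Q * F = P` as formal power series. -/
def IsRationalPS (F : PowerSeries ℂ) : Prop :=
  ∃ (P Q : Polynomial ℂ), Q.coeff 0 ≠ 0 ∧ (Q : PowerSeries ℂ) * F = (P : PowerSeries ℂ)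

/-- The ordinary generating function `Γ_γ(z) = ∑_{n ≥ 1} γ_n z^n` of a sequence. -/
noncomputable def OGF (γ : ℕ → ℂ) : PowerSeries ℂ :=
  PowerSeries.mk fun n => if n = 0 then 0 else γ n

/-- The Lambert series `L_γ(z) = ∑_{n ≥ 1} γ_n z^n / (1 - z^n)`, given by its
coefficients: the `m`-th coefficient is the divisor sum `∑_{d ∣ m} γ d`. -/
noncomputable def LambertSeries (γ : ℕ → ℂ) : PowerSeries ℂ :=
  PowerSeries.mk fun m => ∑ d ∈ m.divisors, γ d

lemma ls_int_jacobson : IsJacobsonRing ℤ := by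
  rw [isJacobsonRing_iff_prime_eq]
  intro P hP
  by_cases h0 : P = ⊥
  · subst h0
    rw [eq_bot_iff]
    intro n hn
    rw [Ideal.mem_bot]
    by_contra hne
    obtain ⟨p, hp1, hp⟩ := Nat.exists_infinite_primes (n.natAbs + 1)
    have hpp : Prime (p : ℤ) := Nat.prime_iff_prime_int.mp hp
    have hmax : (Ideal.span {(p : ℤ)}).IsMaximal :=
      PrincipalIdealRing.isMaximal_of_irreducible hpp.irreducible
    have hmem : n ∈ Ideal.span {(p : ℤ)} := by
      rw [Ideal.jacobson, Submodule.mem_sInf] at hn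
      exact hn _ ⟨bot_le, hmax⟩
    rw [Ideal.mem_span_singleton] at hmem
    have := Int.natAbs_dvd_natAbs.mpr hmem
    have := Nat.le_of_dvd (Int.natAbs_pos.mpr hne) this
    simp at this
    omega
  · have := IsPrime.to_maximal_ideal h0
    exact Ideal.jacobson_eq_self_of_isMaximal

lemma ls_finite_field (K : Type*) [Field K] [inst : Algebra ℤ K] [Algebra.FiniteType ℤ K] :
    Finite K := by
  obtain rfl : inst = Ring.toIntAlgebra K := Subsingleton.elim _ _
  have := ls_int_jacobson
  have := finite_of_finite_type_of_isJacobsonRing ℤ K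
  obtain ⟨p, hp⟩ := CharP.exists K
  rcases CharP.char_is_prime_or_zero K p with h | h
  · have : Fact p.Prime := ⟨h⟩
    let := ZMod.algebra K p
    have : Module.Finite (ZMod p) K := Module.Finite.of_restrictScalars_finite ℤ (ZMod p) K
    exact Module.finite_of_finite (ZMod p)
  · subst h
    have := CharP.charP_to_charZero K
    exfalso
    apply Int.not_isField
    exact isField_of_isIntegral_of_isField (R := ℤ) (S := K)
      (by simpa using (Int.cast_injective (α := K))) (Field.toIsField K)

lemma ls_periodic {K : Type*} [Field K] [Finite K] (f : ℕ → K) (k n0 : ℕ) (e : ℕ → K)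
    (he : e k = 1)
    (h : ∀ n, n0 ≤ n → ∑ i ∈ Finset.range (k + 1), e i * f (n + i) = 0) :
    ∃ N n1, 0 < N ∧ ∀ n, n1 ≤ n → f (n + N) = f n := by
  obtain ⟨x, y, hxy, hs⟩ := Finite.exists_ne_map_eq_of_infinite
    (fun (n : ℕ) (i : Fin k) => f (n0 + n + i))
  wlog hlt : x < y generalizing x y
  · exact this y x hxy.symm hs.symm (by omega)
  have key : ∀ j, f (n0 + x + j) = f (n0 + y + j) := by
    intro j
    induction j using Nat.strong_induction_on with
    | _ j ih =>
      by_cases hj : j < k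
      · exact congrFun hs ⟨j, hj⟩
      · obtain ⟨t, rfl⟩ : ∃ t, j = t + k := ⟨j - k, by omega⟩
        have h1 := h (n0 + x + t) (by omega)
        have h2 := h (n0 + y + t) (by omega)
        rw [Finset.sum_range_succ, he, one_mul] at h1 h2
        have : ∑ i ∈ Finset.range k, e i * f (n0 + x + t + i)
            = ∑ i ∈ Finset.range k, e i * f (n0 + y + t + i) := by
          apply Finset.sum_congr rfl
          intro i hi
          rw [Finset.mem_range] at hi
          have := ih (t + i) (by omega)
          rw [← add_assoc, ← add_assoc] at this
          rw [this]
        rw [this] at h1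
        rw [← add_assoc, ← add_assoc]
        exact add_left_cancel (h1.trans h2.symm)
  refine ⟨y - x, n0 + x, by omega, fun n hn => ?_⟩
  have := key (n - (n0 + x))
  rw [show n0 + x + (n - (n0 + x)) = n by omega,
    show n0 + y + (n - (n0 + x)) = n + (y - x) by omega] at this
  exact this.symm

lemma ls_modEq {K : Type*} (f : ℕ → K) (N n1 : ℕ)
    (h : ∀ n, n1 ≤ n → f (n + N) = f n) {x y : ℕ} (hx : n1 ≤ x) (hy : n1 ≤ y)
    (hxy : x ≡ y [MOD N]) : f x = f y := by
  have hm : ∀ j n, n1 ≤ n → f (n + N * j) = f n := by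
    intro j
    induction j with
    | zero => intro n _; simp
    | succ j ih =>
      intro n hn
      rw [Nat.mul_succ, ← add_assoc, h _ (by omega), ih n hn]
  rcases le_total x y with hle | hle
  · obtain ⟨j, hj⟩ := (Nat.modEq_iff_dvd' hle).mp hxy
    rw [show y = x + N * j by omega, hm _ _ hx]
  · obtain ⟨j, hj⟩ := (Nat.modEq_iff_dvd' hle).mp hxy.symm
    rw [show x = y + N * j by omega, hm _ _ hy]

lemma ls_sum_div {K : Type*} [AddCommMonoid K] (g : ℕ → K) {p n : ℕ} (hp : p.Prime)
    (hn : ¬ p ∣ n) (j : ℕ) :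
    ∑ d ∈ (n * p ^ j).divisors, g d
      = ∑ i ∈ Finset.range (j + 1), ∑ d ∈ n.divisors, g (d * p ^ i) := by
  have hc : n.Coprime (p ^ j) := ((Nat.Prime.coprime_iff_not_dvd hp).mpr hn).symm.pow_right j
  rw [Nat.divisors_mul, Finset.mul_def, Finset.sum_image hc.mul_injOn_divisors,
    Finset.sum_product_right, Nat.sum_divisors_prime_pow hp]

lemma ls_core {K : Type*} [Field K] (γ : ℕ → K) (N n1 : ℕ) (hN : 0 < N)
    (h1 : ∀ n, n1 ≤ n → γ (n + N) = γ n)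
    (h2 : ∀ n, n1 ≤ n → ∑ d ∈ (n + N).divisors, γ d = ∑ d ∈ n.divisors, γ d) :
    ∀ n, n1 ≤ n → 0 < n → γ n = 0 := by
  set M := N * n1 + 1 with hM
  have hMn : n1 ≤ M := by nlinarith
  have hM1 : M ≡ 1 [MOD N] := by simp [hM, Nat.ModEq]
  set g : ℕ → K := fun d => γ (d * M) with hg
  have hle : ∀ {d x : ℕ}, 0 < d → n1 ≤ x → n1 ≤ d * x := fun hd hx => by nlinarith
  have hgp : ∀ {d p : ℕ}, 0 < d → n1 ≤ p → p ≡ 1 [MOD N] → γ (d * p) = g d := by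
    intro d p hd hp hpm
    exact ls_modEq γ N n1 h1 (hle hd hp) (hle hd hMn) ((hpm.trans hM1.symm).mul_left d)
  have hgg : ∀ {d p : ℕ}, 0 < d → 0 < p → p ≡ 1 [MOD N] → g (d * p) = g d := by
    intro d p hd hp hpm
    exact ls_modEq γ N n1 h1 (hle (Nat.mul_pos hd hp) hMn) (hle hd hMn)
      (by simpa using (hpm.mul_left d).mul_right M)
  have hprime : ∀ n, ∃ p, p.Prime ∧ n < p ∧ p ≡ 1 [MOD N] := fun n =>
    Nat.exists_prime_gt_modEq_one n hN.ne'
  have hA : ∀ n, n1 ≤ n → 0 < n → ∑ d ∈ n.divisors, g d = 0 := by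
    intro n hn hn0
    obtain ⟨p, hp, hpn, hpm⟩ := hprime (n + n1)
    have hnd : ¬ p ∣ n := fun hd => by have := Nat.le_of_dvd hn0 hd; omega
    have e1 := ls_sum_div γ hp hnd 1
    have e2 := ls_modEq (fun n => ∑ d ∈ n.divisors, γ d) N n1 h2
      (x := n * p ^ 1) (y := n) (hle hn0 (by simp; omega)) hn
      (by simpa using hpm.mul_left n)
    rw [e2, Finset.sum_range_succ, Finset.sum_range_one] at e1
    simp only [pow_zero, mul_one, pow_one] at e1
    have e3 := left_eq_add.mp e1
    rw [← e3]
    apply Finset.sum_congr rfl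
    intro d hd
    exact (hgp (Nat.pos_of_mem_divisors hd) (by omega) hpm).symm
  have hB : ∀ n, 0 < n → ∑ d ∈ n.divisors, g d = 0 := by
    intro n hn0
    obtain ⟨p, hp, hpn, hpm⟩ := hprime (n + n1)
    have hnd : ¬ p ∣ n := fun hd => by have := Nat.le_of_dvd hn0 hd; omega
    have hj : ∀ j, 0 < j → ((j + 1 : ℕ) : K) * ∑ d ∈ n.divisors, g d = 0 := by
      intro j hj
      have hpj : p ≤ p ^ j := Nat.le_self_pow hj.ne' p
      have e1 := ls_sum_div g hp hnd j
      rw [hA _ (hle hn0 (by omega)) (Nat.mul_pos hn0 (by omega))] at e1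
      rw [e1, ← nsmul_eq_mul]
      symm
      conv_rhs => rw [← Finset.card_range (j + 1)]
      apply Finset.sum_eq_card_nsmul
      intro i _
      apply Finset.sum_congr rfl
      intro d hd
      exact hgg (Nat.pos_of_mem_divisors hd) (pow_pos hp.pos i) (by simpa using hpm.pow i)
    have a1 := hj 1 (by norm_num)
    have a2 := hj 2 (by norm_num)
    push_cast at a1 a2
    linear_combination a2 - a1
  have hC : ∀ n, 0 < n → g n = 0 := by
    intro n
    induction n using Nat.strong_induction_on with
    | _ n ih =>
      intro hn
      have := hB n hn
      rw [← Nat.cons_self_properDivisors hn.ne', Finset.sum_cons, Finset.sum_eq_zero, add_zero] at this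
      · exact this
      · intro d hd
        rw [Nat.mem_properDivisors] at hd
        exact ih d hd.2 (Nat.pos_of_dvd_of_pos hd.1 hn)
  intro n hn hn0
  rw [← hC n hn0]
  exact ls_modEq γ N n1 h1 hn (hle hn0 hMn) (by simpa using (hM1.symm.mul_left n))

/-- everything in a finite field -/
lemma ls_finite {K : Type*} [Field K] [Finite K] (γ : ℕ → K) (k n0 : ℕ) (e : ℕ → K)
    (he : e k = 1) (he0 : e 0 ≠ 0)
    (h : ∀ n, n0 ≤ n → ∑ i ∈ Finset.range (k + 1), e i * γ (n + i) = 0)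
    (k' n0' : ℕ) (e' : ℕ → K) (he' : e' k' = 1)
    (h' : ∀ n, n0' ≤ n →
      ∑ i ∈ Finset.range (k' + 1), e' i * ∑ d ∈ (n + i).divisors, γ d = 0) :
    ∀ n, n0 ≤ n → γ n = 0 := by
  obtain ⟨N, n1, hN, hp⟩ := ls_periodic γ k n0 e he h
  obtain ⟨N', n1', hN', hp'⟩ := ls_periodic (fun n => ∑ d ∈ n.divisors, γ d) k' n0' e' he' h'
  have hz := ls_core γ (N * N') (n1 + n1') (Nat.mul_pos hN hN')
    (fun n hn => ls_modEq γ N n1 hp (by omega) (by omega) (by simp [Nat.ModEq]))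
    (fun n hn => ls_modEq (fun n => ∑ d ∈ n.divisors, γ d) N' n1' hp' (by omega) (by omega)
      (by simp [Nat.ModEq]))
  have hback : ∀ t n, n0 ≤ n → n1 + n1' + 1 ≤ n + t → γ n = 0 := by
    intro t
    induction t with
    | zero => intro n _ hn; exact hz n (by omega) (by omega)
    | succ t ih =>
      intro n hn hnt
      have := h n hn
      rw [Finset.sum_range_succ', Finset.sum_eq_zero] at this
      · simpa [he0] using this
      · intro i _
        rw [ih (n + (i + 1)) (by omega) (by omega), mul_zero]
  intro n hn
  exact hback (n1 + n1' + 1) n hn (by omega)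

lemma ls_rec {F : PowerSeries ℂ} (hF : IsRationalPS F) :
    ∃ (k n0 : ℕ) (e : ℕ → ℂ), 0 < n0 ∧ e k = 1 ∧ e 0 ≠ 0 ∧
      ∀ n, n0 ≤ n → ∑ i ∈ Finset.range (k + 1), e i * PowerSeries.coeff (n + i) F = 0 := by
  obtain ⟨P, Q, hQ, h⟩ := hF
  have hQ0 : Q ≠ 0 := by rintro rfl; simp at hQ
  set k := Q.natDegree with hk
  refine ⟨k, P.natDegree + 1, fun i => Q.coeff (k - i) / Q.coeff 0, by omega, ?_, ?_, ?_⟩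
  · simp [hQ]
  · simpa [hQ, hk] using hQ0
  · intro n hn
    have h1 := congrArg (PowerSeries.coeff (n + k)) h
    rw [Polynomial.coeff_coe, Polynomial.coeff_eq_zero_of_natDegree_lt (by omega),
      PowerSeries.coeff_mul, Finset.Nat.sum_antidiagonal_eq_sum_range_succ_mk] at h1
    simp only [Polynomial.coeff_coe] at h1
    have h2 : ∑ i ∈ Finset.range (k + 1), Q.coeff i * PowerSeries.coeff (n + k - i) F = 0 := by
      rw [← h1]
      apply Finset.sum_subset
      · intro i hi
        rw [Finset.mem_range] at *
        omega
      · intro i _ hi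
        rw [Finset.mem_range] at hi
        rw [Polynomial.coeff_eq_zero_of_natDegree_lt (by omega), zero_mul]
    rw [← Finset.sum_range_reflect] at h2
    have h3 : (∑ i ∈ Finset.range (k + 1), Q.coeff (k - i) * PowerSeries.coeff (n + i) F) = 0 := by
      rw [← h2]
      apply Finset.sum_congr rfl
      intro i hi
      rw [Finset.mem_range] at hi
      rw [show k + 1 - 1 - i = k - i by omega, show n + k - (k - i) = n + i by omega]
    calc _ = (∑ i ∈ Finset.range (k + 1), Q.coeff (k - i) * PowerSeries.coeff (n + i) F)
          / Q.coeff 0 := by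
          rw [Finset.sum_div]
          exact Finset.sum_congr rfl fun i _ => by ring
      _ = 0 := by rw [h3, zero_div]

lemma ls_main (γ : ℕ → ℂ) (k n0 : ℕ) (e : ℕ → ℂ)
    (he : e k = 1) (he0 : e 0 ≠ 0)
    (h : ∀ n, n0 ≤ n → ∑ i ∈ Finset.range (k + 1), e i * γ (n + i) = 0)
    (k' n0' : ℕ) (e' : ℕ → ℂ) (he' : e' k' = 1)
    (h' : ∀ n, n0' ≤ n →
      ∑ i ∈ Finset.range (k' + 1), e' i * ∑ d ∈ (n + i).divisors, γ d = 0) :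
    ∀ n, n0 ≤ n → γ n = 0 := by
  intro m hm
  by_contra hne
  classical
  let S : Finset ℂ := (Finset.range (n0 + k)).image γ ∪ (Finset.range (k + 1)).image e
    ∪ (Finset.range (k' + 1)).image e' ∪ {(e 0)⁻¹, (γ m)⁻¹}
  let R := Algebra.adjoin ℤ (S : Set ℂ)
  have : Algebra.FiniteType ℤ R := Subalgebra.fg_iff_finiteType _ |>.mp ⟨S, rfl⟩
  have hsub : ∀ x ∈ S, x ∈ R := fun x hx => Algebra.subset_adjoin hx
  have heR : ∀ i, i < k + 1 → e i ∈ R := fun i hi => hsub _ (by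
    simp only [S, Finset.mem_union, Finset.mem_image, Finset.mem_range]
    exact Or.inl (Or.inl (Or.inr ⟨i, hi, rfl⟩)))
  have heR' : ∀ i, i < k' + 1 → e' i ∈ R := fun i hi => hsub _ (by
    simp only [S, Finset.mem_union, Finset.mem_image, Finset.mem_range]
    exact Or.inl (Or.inr ⟨i, hi, rfl⟩))
  have hi1 : (e 0)⁻¹ ∈ R := hsub _ (by simp [S])
  have hi2 : (γ m)⁻¹ ∈ R := hsub _ (by simp [S])
  have hγR : ∀ j, γ j ∈ R := by
    intro j
    induction j using Nat.strong_induction_on with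
    | _ j ih =>
      by_cases hj : j < n0 + k
      · apply hsub
        simp only [S, Finset.mem_union, Finset.mem_image, Finset.mem_range]
        exact Or.inl (Or.inl (Or.inl ⟨j, hj, rfl⟩))
      · have := h (j - k) (by omega)
        rw [Finset.sum_range_succ, he, one_mul, show j - k + k = j by omega] at this
        rw [eq_neg_of_add_eq_zero_right this]
        apply neg_mem
        apply sum_mem
        intro i hi
        rw [Finset.mem_range] at hi
        exact mul_mem (heR i (by omega)) (ih _ (by omega))
  obtain ⟨I, hI⟩ := Ideal.exists_maximal R
  let := Ideal.Quotient.field I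
  have : Algebra.FiniteType ℤ (R ⧸ I) :=
    Algebra.FiniteType.of_surjective (Ideal.Quotient.mkₐ ℤ I) Ideal.Quotient.mk_surjective
  have := ls_finite_field (R ⧸ I)
  let φ : R →+* R ⧸ I := Ideal.Quotient.mk I
  let G : ℕ → R := fun n => ⟨γ n, hγR n⟩
  let E : ℕ → R := fun i => if hi : i < k + 1 then ⟨e i, heR i hi⟩ else 0
  let E' : ℕ → R := fun i => if hi : i < k' + 1 then ⟨e' i, heR' i hi⟩ else 0
  have hE : ∀ i, i < k + 1 → (E i : ℂ) = e i := fun i hi => by simp only [E, dif_pos hi]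
  have hE' : ∀ i, i < k' + 1 → (E' i : ℂ) = e' i := fun i hi => by simp only [E', dif_pos hi]
  have hunit : ∀ x y : R, (x : ℂ) * y = 1 → φ x ≠ 0 := by
    intro x y hxy h0
    have : x * y = 1 := Subtype.ext (by simpa using hxy)
    have := congrArg φ this
    rw [map_mul, h0, zero_mul, map_one] at this
    exact zero_ne_one this
  refine hunit (G m) ⟨_, hi2⟩ (mul_inv_cancel₀ hne) ?_
  refine ls_finite (fun n => φ (G n)) k n0 (fun i => φ (E i)) ?_ ?_ ?_ k' n0'
    (fun i => φ (E' i)) ?_ ?_ m hm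
  · have : E k = 1 := Subtype.ext (by rw [hE k (by omega), he]; rfl)
    simp [this]
  · exact hunit (E 0) ⟨_, hi1⟩ (by rw [hE 0 (by omega)]; exact mul_inv_cancel₀ he0)
  · intro n hn
    have : ∑ i ∈ Finset.range (k + 1), E i * G (n + i) = 0 := by
      apply Subtype.ext
      rw [← Subalgebra.val_apply, map_sum]
      rw [ZeroMemClass.coe_zero, ← h n hn]
      apply Finset.sum_congr rfl
      intro i hi
      rw [map_mul, Subalgebra.val_apply, hE i (Finset.mem_range.mp hi)]
      rfl
    simpa using congrArg φ this
  · have : E' k' = 1 := Subtype.ext (by rw [hE' k' (by omega), he']; rfl)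
    simp [this]
  · intro n hn
    have : ∑ i ∈ Finset.range (k' + 1), E' i * ∑ d ∈ (n + i).divisors, G d = 0 := by
      apply Subtype.ext
      rw [← Subalgebra.val_apply, map_sum]
      rw [ZeroMemClass.coe_zero, ← h' n hn]
      apply Finset.sum_congr rfl
      intro i hi
      rw [map_mul, map_sum, Subalgebra.val_apply, hE' i (Finset.mem_range.mp hi)]
      rfl
    simpa using congrArg φ this

theorem stmt_1 (γ : ℕ → ℂ)
    (hΓ : IsRationalPS (OGF γ)) (hL : IsRationalPS (LambertSeries γ)) :
    (∃ N : ℕ, ∀ n, N ≤ n → γ n = 0) ∧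
    (∃ P : Polynomial ℂ, OGF γ = (P : PowerSeries ℂ)) := by
  obtain ⟨k, n0, e, hn0, he, he0, h⟩ := ls_rec hΓ
  obtain ⟨k', n0', e', _, he', _, h'⟩ := ls_rec hL
  have hz := ls_main γ k n0 e he he0 (by
    intro n hn
    rw [← h n hn]
    apply Finset.sum_congr rfl
    intro i _
    rw [OGF, PowerSeries.coeff_mk, if_neg (by omega)]) k' n0' e' he' (by
    intro n hn
    rw [← h' n hn]
    apply Finset.sum_congr rfl
    intro i _
    rw [LambertSeries, PowerSeries.coeff_mk])
  refine ⟨⟨n0, hz⟩, PowerSeries.trunc n0 (OGF γ), ?_⟩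
  ext n
  rw [Polynomial.coeff_coe, PowerSeries.coeff_trunc]
  split_ifs with hn
  · rfl
  · rw [OGF, PowerSeries.coeff_mk, if_neg (by omega), hz n (by omega)]
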